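/- Policy improvement for long-run mean-CVaR: let β ≥ 0 and f_β(y,i,a) := y + (1-α)⁻¹·max(c(i,a) - y, 0) + β·c(i,a). Let d, d' be deterministic policies, y := VaR^d, and let g_β : S → ℝ satisfy the Poisson equation g_β(i) = f_β(y,i,d(i)) - Σ_{j∈S} π^d(j)·f_β(y,j,d(j)) + Σ_{j∈S} p(j|i,d(i))·g_β(j) for all i. If Σ_{j∈S} p(j|i,d'(i))·g_β(j) + f_β(y,i,d'(i)) ≤ Σ_{j∈S} p(j|i,d(i))·g_β(j) + f_β(y,i,d(i)) for every i ∈ S, then CVaR^{d'} + β·η^{d'}(c) ≤ CVaR^{d} + β·η^{d}(c), where η^d(c) := Σ_{i∈S} π^d(i)·c(i,d(i)). -/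

import Mathlib

/-- The pseudo-CVaR cost `c̃(y,i,a) = y + (1-α)⁻¹ max(c(i,a) - y, 0)`. -/
noncomputable def ctil {S A : Type*} (α : ℝ) (c : S → A → ℝ) (y : ℝ) (i : S) (a : A) : ℝ :=
  y + (1 - α)⁻¹ * max (c i a - y) 0

/-- The pseudo CVaR `ṼC^d(y) = Σ_i π(i) c̃(y,i,d(i))` of a deterministic policy `d`
with stationary distribution `π`. -/
noncomputable def pC {S A : Type*} [Fintype S] (α : ℝ) (c : S → A → ℝ) (π : S → ℝ)
    (d : S → A) (y : ℝ) : ℝ :=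
  ∑ i, π i * ctil α c y i (d i)

/-- The long-run CVaR `CVaR^d = inf_{y ∈ ℝ} ṼC^d(y)`. -/
noncomputable def CV {S A : Type*} [Fintype S] (α : ℝ) (c : S → A → ℝ) (π : S → ℝ)
    (d : S → A) : ℝ :=
  sInf (Set.range (pC α c π d))

/-- The long-run VaR `VaR^d = inf {w : Σ_{i : c(i,d(i)) ≤ w} π(i) ≥ α}`. -/
noncomputable def VaR {S A : Type*} [Fintype S] (α : ℝ) (c : S → A → ℝ) (π : S → ℝ)
    (d : S → A) : ℝ :=
  sInf {w : ℝ | α ≤ ∑ i, if c i (d i) ≤ w then π i else 0}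

/-- The combined mean-CVaR cost `f_β(y,i,a) = c̃(y,i,a) + β c(i,a)`. -/
noncomputable def fbeta {S A : Type*} (α β : ℝ) (c : S → A → ℝ) (y : ℝ) (i : S) (a : A) : ℝ :=
  y + (1 - α)⁻¹ * max (c i a - y) 0 + β * c i a

/-- The long-run average of `f_β(y)` under policy `d`: `η^d(f_β(y))`. -/
noncomputable def etafbeta {S A : Type*} [Fintype S] (α β : ℝ) (c : S → A → ℝ)
    (π : S → ℝ) (d : S → A) (y : ℝ) : ℝ :=
  ∑ i, π i * fbeta α β c y i (d i)

/-- The long-run average cost `η^d(c) = Σ_i π(i) c(i,d(i))`. -/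
noncomputable def etac {S A : Type*} [Fintype S] (c : S → A → ℝ) (π : S → ℝ)
    (d : S → A) : ℝ :=
  ∑ i, π i * c i (d i)

open Filter Topology in
/-- The distribution function of a finitely supported law is at least `α` at its `α`-quantile,
and its left limit there is at most `α`. -/
theorem quantile_bounds {S : Type*} [Fintype S] (α : ℝ) (hα : α ∈ Set.Ioo (0 : ℝ) 1)
    (x π : S → ℝ) (h0 : ∀ i, 0 ≤ π i) (h1 : ∑ i, π i = 1) (v : ℝ)
    (hv : v = sInf {w : ℝ | α ≤ ∑ i, if x i ≤ w then π i else 0}) :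
    (α ≤ ∑ i, if x i ≤ v then π i else 0) ∧ (∑ i, if x i < v then π i else 0) ≤ α := by
  set W : Set ℝ := {w : ℝ | α ≤ ∑ i, if x i ≤ w then π i else 0} with hW
  have hne : W.Nonempty := by
    obtain ⟨M, hM⟩ := (Set.finite_range x).bddAbove
    refine ⟨M, ?_⟩
    have hx : ∀ i, x i ≤ M := fun i => hM ⟨i, rfl⟩
    simpa [hW, hx, h1] using hα.2.le
  have hbdd : BddBelow W := by
    obtain ⟨m, hm⟩ := (Set.finite_range x).bddBelow
    refine ⟨m, fun w hw => ?_⟩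
    by_contra! hlt
    have hx : ∀ i, ¬ x i ≤ w := fun i => not_le.2 (hlt.trans_le (hm ⟨i, rfl⟩))
    have : α ≤ 0 := by simpa [hW, hx] using hw
    exact absurd hα.1 (not_lt.2 this)
  constructor
  · have hnear : ∀ᶠ w in 𝓝[>] v, ∀ i, x i ≤ w → x i ≤ v := by
      refine eventually_all.2 fun i => ?_
      by_cases hi : x i ≤ v
      · exact Eventually.of_forall fun _ _ => hi
      · filter_upwards [Ioo_mem_nhdsGT (not_le.1 hi)] with w hw hle
        exact absurd hw.2 (not_lt.2 hle)
    obtain ⟨w, hw, hvw⟩ := (hnear.and self_mem_nhdsWithin).exists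
    obtain ⟨u, hu, huw⟩ := exists_lt_of_csInf_lt hne (hv ▸ hvw : sInf W < w)
    refine le_trans hu (Finset.sum_le_sum fun i _ => ?_)
    have := hw i
    have := h0 i
    split_ifs <;> grind
  · have hnear : ∀ᶠ w in 𝓝[<] v, ∀ i, x i < v → x i ≤ w := by
      refine eventually_all.2 fun i => ?_
      by_cases hi : x i < v
      · filter_upwards [Ioo_mem_nhdsLT hi] with w hw _
        exact hw.1.le
      · exact Eventually.of_forall fun _ h => absurd h hi
    obtain ⟨w, hw, hwv⟩ := (hnear.and self_mem_nhdsWithin).exists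
    have hlt : ∑ i, (if x i ≤ w then π i else 0) < α := by
      by_contra! h
      exact absurd (csInf_le hbdd h) (not_le.2 (hv ▸ hwv))
    refine le_trans (Finset.sum_le_sum fun i _ => ?_) hlt.le
    have := hw i
    have := h0 i
    split_ifs <;> grind

/-- The pseudo CVaR is minimized at the value at risk. -/
theorem pC_VaR_le {S A : Type*} [Fintype S] (α : ℝ) (hα : α ∈ Set.Ioo (0 : ℝ) 1)
    (c : S → A → ℝ) (π : S → ℝ) (h0 : ∀ i, 0 ≤ π i) (h1 : ∑ i, π i = 1)
    (d : S → A) (y : ℝ) : pC α c π d (VaR α c π d) ≤ pC α c π d y := by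
  obtain ⟨hge, hle⟩ := quantile_bounds α hα (fun i => c i (d i)) π h0 h1 (VaR α c π d) rfl
  set v := VaR α c π d
  have hα' : 0 < 1 - α := sub_pos.2 hα.2
  have expand : ∀ z, pC α c π d z = z + (1 - α)⁻¹ * ∑ i, π i * max (c i (d i) - z) 0 := by
    intro z
    simp only [pC, ctil, mul_add, Finset.sum_add_distrib, ← Finset.sum_mul, h1, one_mul,
      Finset.mul_sum]
    congr 1
    exact Finset.sum_congr rfl fun i _ => by ring
  suffices h : (∑ i, π i * max (c i (d i) - v) 0) + (1 - α) * (v - y) ≤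
      ∑ i, π i * max (c i (d i) - y) 0 by
    have := mul_le_mul_of_nonneg_left h (inv_nonneg.2 hα'.le)
    rw [mul_add, inv_mul_cancel_left₀ hα'.ne'] at this
    rw [expand, expand]
    linarith
  rcases le_total v y with hvy | hyv
  · have hsum : (∑ i, π i * max (c i (d i) - v) 0) +
        (1 - ∑ i, if c i (d i) ≤ v then π i else 0) * (v - y) ≤
        ∑ i, π i * max (c i (d i) - y) 0 := by
      rw [← h1, ← Finset.sum_sub_distrib, Finset.sum_mul, ← Finset.sum_add_distrib]
      refine Finset.sum_le_sum fun i _ => ?_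
      split_ifs with hi
      · rw [max_eq_right (by linarith : c i (d i) - v ≤ 0)]
        have := mul_nonneg (h0 i) (le_max_right (c i (d i) - y) 0)
        linarith
      · rw [max_eq_left (by linarith : 0 ≤ c i (d i) - v)]
        have := mul_le_mul_of_nonneg_left (le_max_left (c i (d i) - y) 0) (h0 i)
        linarith
    nlinarith [mul_nonneg (sub_nonneg.2 hge) (sub_nonneg.2 hvy)]
  · have hsum : (∑ i, π i * max (c i (d i) - v) 0) +
        (1 - ∑ i, if c i (d i) < v then π i else 0) * (v - y) ≤
        ∑ i, π i * max (c i (d i) - y) 0 := by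
      rw [← h1, ← Finset.sum_sub_distrib, Finset.sum_mul, ← Finset.sum_add_distrib]
      refine Finset.sum_le_sum fun i _ => ?_
      split_ifs with hi
      · rw [max_eq_right (by linarith : c i (d i) - v ≤ 0)]
        have := mul_nonneg (h0 i) (le_max_right (c i (d i) - y) 0)
        linarith
      · rw [max_eq_left (by linarith : 0 ≤ c i (d i) - v)]
        have := mul_le_mul_of_nonneg_left (le_max_left (c i (d i) - y) 0) (h0 i)
        linarith
    nlinarith [mul_nonneg (sub_nonneg.2 hle) (sub_nonneg.2 hyv)]

/-- If the law `π` is stationary for `P` and `f + P g ≤ g + η` pointwise, then the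
`π`-average of `f` is at most `η`. -/
theorem sum_mul_le_of_stationary {S : Type*} [Fintype S] (π : S → ℝ) (P : S → S → ℝ)
    (h0 : ∀ i, 0 ≤ π i) (h1 : ∑ i, π i = 1) (hstat : ∀ j, ∑ i, π i * P i j = π j)
    (f g : S → ℝ) (η : ℝ) (h : ∀ i, (∑ j, P i j * g j) + f i ≤ g i + η) :
    ∑ i, π i * f i ≤ η := by
  have hsum := Finset.sum_le_sum fun i (_ : i ∈ Finset.univ) =>
    mul_le_mul_of_nonneg_left (h i) (h0 i)
  have hPg : ∑ i, π i * ∑ j, P i j * g j = ∑ j, π j * g j := by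
    simp only [Finset.mul_sum]
    rw [Finset.sum_comm]
    refine Finset.sum_congr rfl fun j _ => ?_
    rw [← hstat j, Finset.sum_mul]
    exact Finset.sum_congr rfl fun i _ => by ring
  simp only [mul_add, Finset.sum_add_distrib, ← Finset.sum_mul, h1, one_mul] at hsum
  linarith

/-- The average of the combined cost splits into the pseudo CVaR and the average cost. -/
theorem sum_mul_fbeta {S A : Type*} [Fintype S] (α β : ℝ) (c : S → A → ℝ) (π : S → ℝ)
    (d : S → A) (y : ℝ) :
    ∑ i, π i * fbeta α β c y i (d i) = pC α c π d y + β * etac c π d := by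
  simp only [fbeta, pC, ctil, etac, Finset.mul_sum, ← Finset.sum_add_distrib]
  exact Finset.sum_congr rfl fun i _ => by ring

/-- Policy improvement for long-run mean-CVaR: an improvement in the
Bellman-type comparison with cost `f_β` at `y = VaR^d` yields a policy with no larger
combined mean-CVaR objective. -/
theorem mean_cvar_policy_improvement
    {S A : Type*} [Fintype S] [Fintype A] [Nonempty S] [Nonempty A]
    (p : S → A → S → ℝ) (hp0 : ∀ i a j, 0 ≤ p i a j) (hp1 : ∀ i a, ∑ j, p i a j = 1)
    (c : S → A → ℝ) (α : ℝ) (hα : α ∈ Set.Ioo (0 : ℝ) 1) (β : ℝ) (hβ : 0 ≤ β)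
    (sd : (S → A) → S → ℝ)
    (hsd0 : ∀ d i, 0 ≤ sd d i) (hsd1 : ∀ d, ∑ i, sd d i = 1)
    (hsdstat : ∀ (d : S → A) (j : S), ∑ i, sd d i * p i (d i) j = sd d j)
    (d d' : S → A) (y : ℝ) (hy : y = VaR α c (sd d) d)
    (gβ : S → ℝ)
    (hg : ∀ i, gβ i = fbeta α β c y i (d i) - (∑ j, sd d j * fbeta α β c y j (d j)) +
      ∑ j, p i (d i) j * gβ j)
    (himp : ∀ i, (∑ j, p i (d' i) j * gβ j) + fbeta α β c y i (d' i) ≤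
      (∑ j, p i (d i) j * gβ j) + fbeta α β c y i (d i)) :
    CV α c (sd d') d' + β * etac c (sd d') d' ≤
      CV α c (sd d) d + β * etac c (sd d) d := by
  have hlow : CV α c (sd d') d' ≤ pC α c (sd d') d' y :=
    csInf_le ⟨_, Set.forall_mem_range.2 (pC_VaR_le α hα c _ (hsd0 d') (hsd1 d') d')⟩ ⟨y, rfl⟩
  have hopt : pC α c (sd d) d y ≤ CV α c (sd d) d :=
    le_csInf (Set.range_nonempty _) <| Set.forall_mem_range.2 <| by
      rw [hy]
      exact pC_VaR_le α hα c _ (hsd0 d) (hsd1 d) d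
  have himprove := sum_mul_le_of_stationary (sd d') (fun i => p i (d' i)) (hsd0 d') (hsd1 d')
    (hsdstat d') (fun i => fbeta α β c y i (d' i)) gβ (∑ j, sd d j * fbeta α β c y j (d j))
    fun i => by linarith [himp i, hg i]
  rw [sum_mul_fbeta, sum_mul_fbeta] at himprove
  linarith
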